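/- arXiv:1309.0252 — 5 statements merged into one kernel-verified Lean document; each statement's English description precedes it below -/
import Mathlib

section
/- Let T be a finite tree (a connected acyclic simple graph) that is not isomorphic to any path graph. Then the diameter of T satisfies d(T) ≤ 2·res(T) − 4. -/
open SimpleGraph

/-- A set `S` of vertices is a resolving set of `G` if every pair of distinct vertices
`x, y` is resolved by some vertex `u ∈ S`, i.e. `d(u,x) ≠ d(u,y)`. -/
def IsResolvingSet {V : Type*} (G : SimpleGraph V) (S : Set V) : Prop :=
  ∀ x y : V, x ≠ y → ∃ u ∈ S, G.dist u x ≠ G.dist u y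

/-- The resolving number of `G`: the minimum `k` such that every `k`-element subset of the
vertex set is a resolving set of `G`. -/
noncomputable def resolvingNumber {V : Type*} [Fintype V] (G : SimpleGraph V) : ℕ :=
  sInf {k | ∀ S : Finset V, S.card = k → IsResolvingSet G ↑S}

namespace SimpleGraph

variable {V : Type*} {G : SimpleGraph V}

/-- In a tree, a vertex `w` has at most one neighbour closer than `w` to a given vertex `t`. -/
lemma IsTree.eq_of_adj_of_dist_lt (hG : G.IsTree) {t w x y : V} (hx : G.Adj w x)
    (hy : G.Adj w y) (hxt : G.dist t x < G.dist t w) (hyt : G.dist t y < G.dist t w) :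
    x = y := by
  obtain ⟨p, hp⟩ := hG.connected.exists_walk_length_eq_dist x t
  obtain ⟨q, hq⟩ := hG.connected.exists_walk_length_eq_dist y t
  have hp' : (Walk.cons hx p).IsPath := by
    apply Walk.isPath_of_length_eq_dist
    grind [hG.dist_eq_dist_add_one_of_adj t hx, Walk.length_cons, G.dist_comm (u := t)]
  have hq' : (Walk.cons hy q).IsPath := by
    apply Walk.isPath_of_length_eq_dist
    grind [hG.dist_eq_dist_add_one_of_adj t hy, Walk.length_cons, G.dist_comm (u := t)]
  have h := (hG.existsUnique_path w t).unique hp' hq'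
  simpa using congrArg Walk.snd h

lemma Connected.exists_adj_dist_eq (hG : G.Connected) {v x : V} {k : ℕ}
    (h : G.dist v x = k + 1) : ∃ y, G.Adj x y ∧ G.dist v y = k := by
  obtain ⟨p, hp⟩ := hG.exists_walk_length_eq_dist x v
  cases p with
  | nil => simp at h
  | @cons _ y _ hxy q =>
    refine ⟨y, hxy, ?_⟩
    have h₁ := G.dist_le q
    have h₂ := hG.dist_triangle (u := v) (v := y) (w := x)
    rw [dist_eq_one_iff_adj.mpr hxy.symm] at h₂
    grind [Walk.length_cons, G.dist_comm (u := v)]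

/-- In a finite tree, some vertex has at most one neighbour. -/
lemma IsTree.exists_subsingleton_neighborSet [Finite V] (hG : G.IsTree) :
    ∃ v, (G.neighborSet v).Subsingleton := by
  have := hG.connected.nonempty
  obtain ⟨u, v, huv⟩ := G.exists_dist_eq_diam
  refine ⟨v, fun x hx y hy ↦ ?_⟩
  have hlt : ∀ z, G.Adj v z → G.dist u z < G.dist u v := fun z hz ↦
    lt_of_le_of_ne (huv ▸ dist_le_diam (connected_iff_ediam_ne_top.mp hG.connected))
      (hG.dist_ne_of_adj u hz).symm
  exact hG.eq_of_adj_of_dist_lt hx hy (hlt x hx) (hlt y hy)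

/-- A finite tree in which every vertex has at most two neighbours is a path. -/
lemma IsTree.exists_iso_pathGraph [Fintype V] (hG : G.IsTree)
    (hdeg : ∀ w a b c, G.Adj w a → G.Adj w b → G.Adj w c → a = b ∨ a = c ∨ b = c) :
    ∃ n : ℕ, Nonempty (G ≃g pathGraph n) := by
  obtain ⟨v, hv⟩ := hG.exists_subsingleton_neighborSet
  have hinj : ∀ k x y, G.dist v x = k → G.dist v y = k → x = y := by
    intro k
    induction k with
    | zero =>
      intro x y hx hy
      rw [hG.connected.dist_eq_zero_iff] at hx hy
      exact hx.symm.trans hy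
    | succ k ih =>
      intro x y hx hy
      obtain ⟨x', hxx', hx'⟩ := hG.connected.exists_adj_dist_eq hx
      obtain ⟨y', hyy', hy'⟩ := hG.connected.exists_adj_dist_eq hy
      obtain rfl := ih x' y' hx' hy'
      cases k with
      | zero =>
        obtain rfl := hG.connected.dist_eq_zero_iff.mp hx'
        exact hv hxx'.symm hyy'.symm
      | succ k =>
        obtain ⟨z, hz, hvz⟩ := hG.connected.exists_adj_dist_eq hx'
        rcases hdeg x' x y z hxx'.symm hyy'.symm hz with h | rfl | rfl
        · exact h
        · omega
        · omega
  have hlt : ∀ x, G.dist v x < Fintype.card V := fun x ↦ by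
    obtain ⟨p, hp, hpl⟩ := hG.connected.exists_path_of_dist v x
    exact hpl ▸ hp.length_lt
  let f : V → Fin (Fintype.card V) := fun x ↦ ⟨G.dist v x, hlt x⟩
  have hf : f.Bijective := by
    rw [Fintype.bijective_iff_injective_and_card]
    exact ⟨fun x y h ↦ hinj _ x y rfl (Fin.ext_iff.mp h).symm, by simp⟩
  have hadj : ∀ x y, G.dist v x + 1 = G.dist v y → G.Adj y x := fun x y h ↦ by
    obtain ⟨z, hz, hvz⟩ := hG.connected.exists_adj_dist_eq h.symm
    exact hinj _ z x hvz rfl ▸ hz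
  refine ⟨_, ⟨Equiv.ofBijective f hf, fun {x y} ↦ ?_⟩⟩
  simp only [pathGraph_adj, Equiv.ofBijective_apply, f]
  refine ⟨?_, fun h ↦ ?_⟩
  · rintro (h | h)
    · exact (hadj x y h).symm
    · exact hadj y x h
  · rcases hG.dist_eq_dist_add_one_of_adj v h with h | h <;> omega

/-- In a tree, two neighbours of `w` that do not lie on the path from `w` to `t` are not resolved
by any vertex of that path. -/
lemma IsTree.exists_not_isResolvingSet [Fintype V] (hG : G.IsTree) {t w x y : V} (hxy : x ≠ y)
    (hx : G.Adj w x) (hy : G.Adj w y) (hxt : G.dist t w ≤ G.dist t x)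
    (hyt : G.dist t w ≤ G.dist t y) :
    ∃ S : Finset V, S.card = G.dist w t + 1 ∧ ¬ IsResolvingSet G (S : Set V) := by
  classical
  obtain ⟨p, hp, hpl⟩ := hG.connected.exists_path_of_dist w t
  refine ⟨p.support.toFinset, ?_, fun h ↦ ?_⟩
  · rw [List.toFinset_card_of_nodup hp.support_nodup, Walk.length_support, hpl]
  · obtain ⟨u, hu, hne⟩ := h x y hxy
    replace hu : u ∈ p.support := by simpa using hu
    have hsum : G.dist w u + G.dist u t ≤ G.dist w t := by
      rw [← hpl, ← p.take_spec hu, Walk.length_append]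
      exact add_le_add (dist_le _) (dist_le _)
    have key : ∀ z, G.Adj w z → G.dist t w ≤ G.dist t z → G.dist u z = G.dist u w + 1 := by
      intro z hz hzt
      have htri := hG.connected.dist_triangle (u := t) (v := u) (w := z)
      rcases hG.dist_eq_dist_add_one_of_adj u hz with h | h
      · rw [G.dist_comm (u := w) (v := u), G.dist_comm (u := u) (v := t),
          G.dist_comm (u := w) (v := t)] at hsum
        omega
      · exact h
    exact hne ((key x hx hxt).trans (key y hy hyt).symm)

end SimpleGraph

lemma IsResolvingSet.mono {V : Type*} {G : SimpleGraph V} {S S' : Set V} (hS : IsResolvingSet G S)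
    (h : S ⊆ S') : IsResolvingSet G S' := fun x y hxy ↦
  let ⟨u, hu, hne⟩ := hS x y hxy
  ⟨u, h hu, hne⟩

lemma card_lt_resolvingNumber {V : Type*} [Fintype V] {G : SimpleGraph V} {S : Finset V}
    (hS : ¬ IsResolvingSet G (S : Set V)) : S.card < resolvingNumber G := by
  have hmem : resolvingNumber G ∈ {k | ∀ S : Finset V, S.card = k → IsResolvingSet G ↑S} :=
    Nat.sInf_mem ⟨Fintype.card V + 1, fun S' hS' ↦ absurd S'.card_le_univ (by omega)⟩
  by_contra! hle
  obtain ⟨S', hsub, hcard⟩ := Finset.exists_subset_card_eq hle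
  exact hS ((hmem S' hcard).mono (by exact_mod_cast hsub))

/-- For a tree that is not a path, diam(T) ≤ 2·res(T) − 4. -/
theorem stmt4 {V : Type*} [Fintype V] (T : SimpleGraph V) (hT : T.IsTree)
    (hpath : ¬ ∃ n : ℕ, Nonempty (T ≃g pathGraph n)) :
    T.diam ≤ 2 * resolvingNumber T - 4 := by
  obtain ⟨w, a, b, c, ha, hb, hc, hab, hac, hbc⟩ : ∃ w a b c,
      T.Adj w a ∧ T.Adj w b ∧ T.Adj w c ∧ a ≠ b ∧ a ≠ c ∧ b ≠ c := by
    by_contra! h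
    refine hpath (hT.exists_iso_pathGraph fun w a b c ha hb hc ↦ ?_)
    by_contra! hne
    exact hne.2.2 (h w a b c ha hb hc hne.1 hne.2.1)
  obtain ⟨u, v, huv⟩ : ∃ u v, T.dist u v = T.diam :=
    have := hT.connected.nonempty
    T.exists_dist_eq_diam
  obtain ⟨t, ht⟩ : ∃ t, T.diam ≤ 2 * T.dist w t := by
    have htri := hT.connected.dist_triangle (u := u) (v := w) (w := v)
    rw [huv, T.dist_comm (u := u)] at htri
    rcases le_total (T.dist w u) (T.dist w v) with h | h
    · exact ⟨v, by omega⟩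
    · exact ⟨u, by omega⟩
  obtain ⟨x, y, hxy, hx, hy, hxt, hyt⟩ : ∃ x y, x ≠ y ∧ T.Adj w x ∧ T.Adj w y ∧
      T.dist t w ≤ T.dist t x ∧ T.dist t w ≤ T.dist t y := by
    grind [hT.eq_of_adj_of_dist_lt]
  obtain ⟨S, hcard, hS⟩ := hT.exists_not_isResolvingSet hxy hx hy hxt hyt
  have := card_lt_resolvingNumber hS
  omega
end

section
/- Let G be a finite connected simple graph. Then ω(G) = res(G) + 1 if and only if G is a complete graph. -/
open SimpleGraph

/-- Every subset of size `resolvingNumber G` is resolving. -/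
lemma isResolvingSet_of_card_eq_resolvingNumber {V : Type*} [Fintype V] {G : SimpleGraph V}
    (hG : G.Connected) {S : Finset V} (hS : S.card = resolvingNumber G) :
    IsResolvingSet G ↑S := by
  have hne : {k | ∀ S : Finset V, S.card = k → IsResolvingSet G ↑S}.Nonempty := by
    refine ⟨Fintype.card V, fun S hS x y hxy => ⟨x, ?_, ?_⟩⟩
    · simp [(Finset.card_eq_iff_eq_univ S).1 hS]
    · simpa using (hG.pos_dist_of_ne hxy).ne
  exact Nat.sInf_mem hne S hS

/-- Two vertices of a clique are resolved only by themselves among the vertices of the clique. -/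
lemma SimpleGraph.IsClique.dist_eq_dist {V : Type*} {G : SimpleGraph V} {K : Set V}
    (hK : G.IsClique K) {u x y : V} (hu : u ∈ K) (hx : x ∈ K) (hy : y ∈ K) (hux : u ≠ x)
    (huy : u ≠ y) : G.dist u x = G.dist u y := by
  rw [dist_eq_one_iff_adj.2 (hK hu hx hux), dist_eq_one_iff_adj.2 (hK hu hy huy)]

lemma cliqueNum_le_resolvingNumber_add_one {V : Type*} [Fintype V] {G : SimpleGraph V}
    (hG : G.Connected) : G.cliqueNum ≤ resolvingNumber G + 1 := by
  classical
  by_contra! h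
  obtain ⟨K, hK, hcard⟩ := G.exists_isNClique_cliqueNum
  obtain ⟨S, hSK, hS⟩ := Finset.exists_subset_card_eq (s := K) (n := resolvingNumber G) (by omega)
  have hdiff : 1 < (K \ S).card := by
    rw [Finset.card_sdiff_of_subset hSK]
    omega
  obtain ⟨x, hx, y, hy, hxy⟩ := Finset.one_lt_card.1 hdiff
  rw [Finset.mem_sdiff] at hx hy
  obtain ⟨u, hu, hne⟩ := isResolvingSet_of_card_eq_resolvingNumber hG hS x y hxy
  exact hne (hK.dist_eq_dist (hSK hu) hx.1 hy.1 (ne_of_mem_of_not_mem hu hx.2)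
    (ne_of_mem_of_not_mem hu hy.2))

/-- A vertex outside a clique of size `resolvingNumber G + 1` has pairwise distinct distances
to the vertices of the clique. -/
lemma dist_ne_dist_of_notMem_clique {V : Type*} [Fintype V] {G : SimpleGraph V}
    (hG : G.Connected) {K : Finset V} (hK : G.IsNClique (resolvingNumber G + 1) K) {v x y : V}
    (hv : v ∉ K) (hx : x ∈ K) (hy : y ∈ K) (hxy : x ≠ y) : G.dist v x ≠ G.dist v y := by
  classical
  have hcard : (insert v ((K.erase x).erase y)).card = resolvingNumber G := by
    rw [Finset.card_insert_of_notMem (by simp [hv]),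
      Finset.card_erase_of_mem (by simp [hy, hxy.symm]), Finset.card_erase_of_mem hx, hK.card_eq]
    have := Finset.one_lt_card.2 ⟨x, hx, y, hy, hxy⟩
    rw [hK.card_eq] at this
    omega
  obtain ⟨u, hu, hne⟩ := isResolvingSet_of_card_eq_resolvingNumber hG hcard x y hxy
  simp only [Finset.coe_insert, Finset.coe_erase, Set.mem_insert_iff, Set.mem_sdiff,
    Set.mem_singleton_iff, Finset.mem_coe] at hu
  obtain rfl | ⟨⟨huK, hux⟩, huy⟩ := hu
  · exact hne
  · exact (hne (hK.isClique.dist_eq_dist huK hx hy hux huy)).elim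

lemma SimpleGraph.Connected.exists_adj_mem_notMem {V : Type*} {G : SimpleGraph V}
    (hG : G.Connected) {s : Set V} {a b : V} (ha : a ∈ s) (hb : b ∉ s) :
    ∃ x ∈ s, ∃ y ∉ s, G.Adj x y := by
  obtain ⟨p⟩ := hG.preconnected a b
  obtain ⟨d, -, h₁, h₂⟩ := p.exists_boundary_dart s ha hb
  exact ⟨d.fst, h₁, d.snd, h₂, d.adj⟩

lemma resolvingNumber_top_le {V : Type*} [Fintype V] :
    resolvingNumber (⊤ : SimpleGraph V) ≤ Fintype.card V - 1 := by
  classical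
  refine Nat.sInf_le fun S hS x y hxy => ?_
  by_cases hx : x ∈ S
  · exact ⟨x, hx, by simp [dist_top, hxy]⟩
  by_cases hy : y ∈ S
  · exact ⟨y, hy, by simp [dist_top, hxy.symm]⟩
  have h := Finset.card_le_univ (insert x (insert y S))
  rw [Finset.card_insert_of_notMem (by simp [hxy, hx]), Finset.card_insert_of_notMem hy] at h
  omega

lemma SimpleGraph.card_le_cliqueNum_top {V : Type*} [Fintype V] :
    Fintype.card V ≤ (⊤ : SimpleGraph V).cliqueNum :=
  IsClique.card_le_cliqueNum (tc := fun _ _ _ _ h => h)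

/-- In a connected graph, a clique of size `ω(G) = res(G) + 1` contains every vertex. -/
lemma clique_eq_univ_of_cliqueNum_eq {V : Type*} [Fintype V] {G : SimpleGraph V}
    (hG : G.Connected) (h : G.cliqueNum = resolvingNumber G + 1) {K : Finset V}
    (hK : G.IsNClique (resolvingNumber G + 1) K) : K = Finset.univ := by
  classical
  by_contra hne
  obtain ⟨w, hw⟩ : ∃ w, w ∉ K := by simpa [Finset.eq_univ_iff_forall] using hne
  obtain ⟨z, hz⟩ : K.Nonempty := Finset.card_pos.1 (by rw [hK.card_eq]; omega)
  obtain ⟨a, ha, v, hv, hav⟩ := hG.exists_adj_mem_notMem (s := ↑K) hz hw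
  obtain ⟨b, hb, hvb⟩ : ∃ b ∈ K, ¬ G.Adj v b := by
    by_contra! hall
    have hK' := hK.insert hall
    have := hK'.isClique.card_le_cliqueNum
    rw [hK'.card_eq] at this
    omega
  have hva : G.dist v a = 1 := dist_eq_one_iff_adj.2 hav.symm
  have hab : a ≠ b := fun e => hvb (e ▸ hav.symm)
  have hdist : ∀ c ∈ K, ¬ G.Adj v c → G.dist v c = 2 := by
    intro c hc hvc
    have hac : G.Adj a c := hK.isClique ha hc fun e => hvc (e ▸ hav.symm)
    have h₁ := hG.dist_triangle (u := v) (v := a) (w := c)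
    have h₂ := hG.one_lt_dist_of_ne_of_not_adj (ne_of_mem_of_not_mem hc hv).symm hvc
    rw [hva, dist_eq_one_iff_adj.2 hac] at h₁
    omega
  have hKab : K = {a, b} := by
    refine Finset.Subset.antisymm (fun c hc => ?_) (by simp_all [Finset.insert_subset_iff])
    by_contra hcab
    simp only [Finset.mem_insert, Finset.mem_singleton, not_or] at hcab
    by_cases hvc : G.Adj v c
    · exact dist_ne_dist_of_notMem_clique hG hK hv ha hc (Ne.symm hcab.1)
        (by rw [hva, dist_eq_one_iff_adj.2 hvc])
    · exact dist_ne_dist_of_notMem_clique hG hK hv hb hc (Ne.symm hcab.2)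
        (by rw [hdist b hb hvb, hdist c hc hvc])
  have hres : ({a} : Finset V).card = resolvingNumber G := by
    have := hK.card_eq
    rw [hKab, Finset.card_pair hab] at this
    rw [Finset.card_singleton]
    omega
  obtain ⟨u, hu, hne⟩ := isResolvingSet_of_card_eq_resolvingNumber hG hres v b
    (ne_of_mem_of_not_mem hb hv).symm
  obtain rfl : u = a := by simpa using hu
  exact hne (by rw [dist_eq_one_iff_adj.2 hav, dist_eq_one_iff_adj.2 (hK.isClique ha hb hab)])

theorem stmt8 {V : Type*} [Fintype V] (G : SimpleGraph V) (hG : G.Connected) :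
    G.cliqueNum = resolvingNumber G + 1 ↔ G = ⊤ := by
  constructor
  · intro h
    obtain ⟨K, hK⟩ := G.exists_isNClique_cliqueNum
    rw [h] at hK
    have huniv := clique_eq_univ_of_cliqueNum_eq hG h hK
    refine eq_top_iff.2 fun x y hxy => hK.isClique ?_ ?_ hxy <;> simp [huniv]
  · rintro rfl
    refine le_antisymm (cliqueNum_le_resolvingNumber_add_one hG) ?_
    have := Fintype.card_pos_iff.2 hG.nonempty
    have := resolvingNumber_top_le (V := V)
    have := card_le_cliqueNum_top (V := V)
    omega
end

section
/- Let G be a finite connected simple graph. Then ω(G) = res(G) = 2 if and only if G is isomorphic to a path graph P_n for some n ≥ 3, or G is isomorphic to a cycle graph C_n for some odd n ≥ 5. -/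
open SimpleGraph

namespace SimpleGraph

variable {V : Type*} {G : SimpleGraph V}

/-- Along a path, a coordinate that changes by `±1` on every edge and is injective
always moves in the same direction. -/
lemma Walk.IsPath.exists_forall_getVert_eq_add_mul {A : Type*} [CommRing A] {φ : V → A}
    (hφ : φ.Injective) (hadj : ∀ x y, G.Adj x y → φ y = φ x + 1 ∨ φ y = φ x + -1)
    {u v : V} {p : G.Walk u v} (hp : p.IsPath) :
    ∃ ε : A, (ε = 1 ∨ ε = -1) ∧ ∀ i ≤ p.length, φ (p.getVert i) = φ u + i * ε := by
  induction p with
  | nil => exact ⟨1, Or.inl rfl, by simp⟩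
  | @cons u v w h p ih =>
    rw [cons_isPath_iff] at hp
    obtain ⟨ε, hε, key⟩ := ih hp.1
    obtain ⟨δ, hδ, hv⟩ : ∃ δ : A, (δ = 1 ∨ δ = -1) ∧ φ v = φ u + δ := by
      rcases hadj u v h with h' | h' <;> exact ⟨_, by simp, h'⟩
    refine ⟨δ, hδ, fun i hi => ?_⟩
    rcases i with _ | i
    · simp
    rw [length_cons] at hi
    rw [getVert_cons_succ, key i (by omega), hv]
    rcases i with _ | i
    · simp
    suffices ε = δ by rw [this]; push_cast; ring
    by_contra hne
    have h1 := key 1 (by omega)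
    have h2 : p.getVert 1 = u := by
      apply hφ
      rw [h1, hv]
      rcases hε with rfl | rfl <;> rcases hδ with rfl | rfl <;> simp at hne ⊢
    exact hp.2 (h2 ▸ p.getVert_mem_support 1)

lemma Connected.eq_add_dist_or_eq_sub_dist {A : Type*} [CommRing A] {φ : V → A}
    (hG : G.Connected) (hφ : φ.Injective)
    (hadj : ∀ x y, G.Adj x y → φ y = φ x + 1 ∨ φ y = φ x + -1) (u v : V) :
    φ v = φ u + G.dist u v ∨ φ v = φ u - G.dist u v := by
  obtain ⟨p, hp, hl⟩ := hG.exists_path_of_dist u v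
  obtain ⟨ε, hε, key⟩ := hp.exists_forall_getVert_eq_add_mul hφ hadj
  have := key p.length le_rfl
  rw [Walk.getVert_length, hl] at this
  rcases hε with rfl | rfl
  · left; simpa using this
  · right; rw [this]; ring

lemma Connected.isResolvingSet_of_ne {A : Type*} [CommRing A] {φ : V → A}
    (hG : G.Connected) (hφ : φ.Injective)
    (hadj : ∀ x y, G.Adj x y → φ y = φ x + 1 ∨ φ y = φ x + -1)
    (htwo : ∀ a : A, 2 * a = 0 → a = 0) {S : Set V} {u w : V} (hu : u ∈ S) (hw : w ∈ S)
    (huw : u ≠ w) : IsResolvingSet G S := by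
  intro x y hxy
  by_contra! h
  have sum_eq (v : V) (hv : v ∈ S) : φ x + φ y = 2 * φ v := by
    have hx := hG.eq_add_dist_or_eq_sub_dist hφ hadj v x
    have hy := hG.eq_add_dist_or_eq_sub_dist hφ hadj v y
    rw [h v hv] at hx
    rcases hx with hx | hx <;> rcases hy with hy | hy
    · exact absurd (hφ (hx.trans hy.symm)) hxy
    · rw [hx, hy]; ring
    · rw [hx, hy]; ring
    · exact absurd (hφ (hx.trans hy.symm)) hxy
  refine huw (hφ (sub_eq_zero.mp (htwo _ ?_)))
  linear_combination sum_eq w hw - sum_eq u hu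

lemma cliqueFree_three_of_coordinate {A : Type*} [CommRing A] {φ : V → A}
    (hφ : φ.Injective) (hadj : ∀ x y, G.Adj x y → φ y = φ x + 1 ∨ φ y = φ x + -1)
    (hthree : (3 : A) ≠ 0) : G.CliqueFree 3 := by
  classical
  intro s hs
  obtain ⟨a, b, c, hab, hac, hbc, -⟩ := is3Clique_iff.mp hs
  have hone : (1 : A) ≠ 0 := fun h => hthree (by linear_combination 3 * h)
  have hbc' : φ b ≠ φ c := hφ.ne hbc.ne
  rcases hadj a b hab with h1 | h1 <;> rcases hadj a c hac with h2 | h2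
  · exact hbc' (h1.trans h2.symm)
  · rcases hadj b c hbc with h3 | h3
    · exact hthree (by linear_combination h2 - h1 - h3)
    · exact hone (by linear_combination h2 - h1 - h3)
  · rcases hadj b c hbc with h3 | h3
    · exact hone (by linear_combination h3 + h1 - h2)
    · exact hthree (by linear_combination h3 + h1 - h2)
  · exact hbc' (h1.trans h2.symm)

lemma cliqueNum_eq_two [Finite V] (h3 : G.CliqueFree 3) {u v : V} (h : G.Adj u v) :
    G.cliqueNum = 2 := by
  classical
  apply le_antisymm
  · by_contra! hlt
    obtain ⟨s, hs⟩ := G.exists_isNClique_cliqueNum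
    exact h3.mono hlt s hs
  · have hc : G.IsClique (({u, v} : Finset V) : Set V) := by
      simp [h.ne, h]
    simpa [h.ne] using hc.card_le_cliqueNum

lemma cliqueFree_three_of_cliqueNum_eq_two [Finite V] (h : G.cliqueNum = 2) :
    G.CliqueFree 3 := by
  intro s hs
  have := hs.isClique.card_le_cliqueNum
  rw [hs.card_eq, h] at this
  omega

lemma resolvingNumber_eq_two [Fintype V]
    (hres : ∀ (S : Set V) (u w : V), u ∈ S → w ∈ S → u ≠ w → IsResolvingSet G S)
    {v a b : V} (hab : a ≠ b) (ha : G.Adj v a) (hb : G.Adj v b) : resolvingNumber G = 2 := by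
  classical
  unfold resolvingNumber
  apply le_antisymm
  · refine Nat.sInf_le fun S hS => ?_
    obtain ⟨u, w, huw, rfl⟩ := Finset.card_eq_two.mp hS
    exact hres _ u w (by simp) (by simp) huw
  · refine le_csInf ⟨2, fun S hS => ?_⟩ fun k hk => ?_
    · obtain ⟨u, w, huw, rfl⟩ := Finset.card_eq_two.mp hS
      exact hres _ u w (by simp) (by simp) huw
    · by_contra! hlt
      interval_cases k
      · obtain ⟨u, hu, -⟩ := hk ∅ (by simp) a b hab
        simp at hu
      · obtain ⟨u, hu, hd⟩ := hk {v} (by simp) a b hab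
        obtain rfl : u = v := by simpa using hu
        rw [dist_eq_one_iff_adj.mpr ha, dist_eq_one_iff_adj.mpr hb] at hd
        exact hd rfl

lemma Connected.cliqueNum_and_resolvingNumber_eq_two [Fintype V] {A : Type*} [CommRing A]
    {φ : V → A} (hG : G.Connected) (hφ : φ.Injective)
    (hadj : ∀ x y, G.Adj x y → φ y = φ x + 1 ∨ φ y = φ x + -1)
    (htwo : ∀ a : A, 2 * a = 0 → a = 0) (hthree : (3 : A) ≠ 0)
    {v a b : V} (hab : a ≠ b) (ha : G.Adj v a) (hb : G.Adj v b) :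
    G.cliqueNum = 2 ∧ resolvingNumber G = 2 :=
  ⟨cliqueNum_eq_two (cliqueFree_three_of_coordinate hφ hadj hthree) ha,
    resolvingNumber_eq_two
      (fun _ _ _ hu hw huw => hG.isResolvingSet_of_ne hφ hadj htwo hu hw huw) hab ha hb⟩

lemma cycleGraph_adj_iff_val {n : ℕ} (hn : 2 ≤ n) {u v : Fin n} :
    (cycleGraph n).Adj u v ↔ u.val + 1 = v.val ∨ v.val + 1 = u.val ∨
      (u.val = 0 ∧ v.val + 1 = n) ∨ (v.val = 0 ∧ u.val + 1 = n) := by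
  have hu := u.isLt
  have hv := v.isLt
  rw [cycleGraph_adj']
  rcases lt_trichotomy u v with h | rfl | h
  · rw [Fin.coe_sub_iff_lt.mpr h, Fin.coe_sub_iff_le.mpr h.le]
    rw [Fin.lt_def] at h
    omega
  · rw [Fin.coe_sub_iff_le.mpr le_rfl]
    omega
  · rw [Fin.coe_sub_iff_lt.mpr h, Fin.coe_sub_iff_le.mpr h.le]
    rw [Fin.lt_def] at h
    omega

lemma Connected.cliqueNum_and_resolvingNumber_of_iso_pathGraph [Fintype V] (hG : G.Connected)
    {n : ℕ} (hn : 3 ≤ n) (e : G ≃g pathGraph n) :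
    G.cliqueNum = 2 ∧ resolvingNumber G = 2 := by
  have hadj (i j : Fin n) (h : i.val + 1 = j.val ∨ j.val + 1 = i.val) :
      G.Adj (e.symm i) (e.symm j) := e.symm.map_adj_iff.mpr (pathGraph_adj.mpr h)
  refine hG.cliqueNum_and_resolvingNumber_eq_two (φ := fun x => ((e x).val : ℤ))
    (fun x y h => e.injective (Fin.ext (by simpa using h))) (fun x y h => ?_)
    (fun a h => by omega) (by norm_num)
    (e.symm.injective.ne (a₁ := ⟨0, by omega⟩) (a₂ := ⟨2, by omega⟩) (by simp))
    (hadj ⟨1, by omega⟩ _ (by simp)) (hadj ⟨1, by omega⟩ _ (by simp))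
  have := pathGraph_adj.mp (e.map_adj_iff.mpr h)
  omega

lemma Connected.cliqueNum_and_resolvingNumber_of_iso_cycleGraph [Fintype V] (hG : G.Connected)
    {n : ℕ} (hodd : Odd n) (hn : 5 ≤ n) (e : G ≃g cycleGraph n) :
    G.cliqueNum = 2 ∧ resolvingNumber G = 2 := by
  have hadj (i j : Fin n) (h : i.val + 1 = j.val ∨ j.val + 1 = i.val) :
      G.Adj (e.symm i) (e.symm j) :=
    e.symm.map_adj_iff.mpr ((cycleGraph_adj_iff_val (by omega)).mpr (by omega))
  refine hG.cliqueNum_and_resolvingNumber_eq_two (φ := fun x => ((e x).val : ZMod n))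
    (fun x y h => e.injective (Fin.ext ?_)) (fun x y h => ?_) (fun a h => ?_) ?_
    (e.symm.injective.ne (a₁ := ⟨0, by omega⟩) (a₂ := ⟨2, by omega⟩) (by simp))
    (hadj ⟨1, by omega⟩ _ (by simp)) (hadj ⟨1, by omega⟩ _ (by simp))
  · have h' := (ZMod.natCast_eq_natCast_iff' _ _ _).mp h
    rwa [Nat.mod_eq_of_lt (e x).isLt, Nat.mod_eq_of_lt (e y).isLt] at h'
  · have hn0 : (n : ZMod n) = 0 := ZMod.natCast_self n
    rcases (cycleGraph_adj_iff_val (by omega)).mp (e.map_adj_iff.mpr h) with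
      h | h | ⟨h0, h⟩ | ⟨h0, h⟩
    · left; rw [← h]; push_cast; ring
    · right; rw [← h]; push_cast; ring
    · right
      have h := congrArg (Nat.cast (R := ZMod n)) h
      push_cast at h
      rw [h0]; push_cast
      linear_combination h + hn0
    · left
      have h := congrArg (Nat.cast (R := ZMod n)) h
      push_cast at h
      rw [h0]; push_cast
      linear_combination -h - hn0
  · have hunit : IsUnit ((2 : ℕ) : ZMod n) :=
      (ZMod.isUnit_iff_coprime 2 n).mpr (Nat.coprime_two_left.mpr hodd)
    exact (hunit.mul_right_eq_zero).mp (by exact_mod_cast h)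
  · intro h
    have h3 : ((3 : ℕ) : ZMod n) = 0 := by exact_mod_cast h
    have := Nat.le_of_dvd (by norm_num) ((ZMod.natCast_eq_zero_iff 3 n).mp h3)
    omega

lemma Connected.dist_iso_apply {W : Type*} {H : SimpleGraph W} (hG : G.Connected) (e : G ≃g H)
    (x y : V) : H.dist (e x) (e y) = G.dist x y := by
  have hH : H.Connected := e.connected_iff.mp hG
  apply le_antisymm
  · obtain ⟨p, hp⟩ := hG.exists_walk_length_eq_dist x y
    simpa [hp] using dist_le (p.map e.toHom)
  · obtain ⟨p, hp⟩ := hH.exists_walk_length_eq_dist (e x) (e y)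
    simpa [hp] using dist_le (p.map e.symm.toHom)

lemma odd_of_forall_isResolvingSet_cycleGraph {n : ℕ} (hn : 3 ≤ n)
    (hres : ∀ u w : Fin n, u ≠ w → IsResolvingSet (cycleGraph n) {u, w}) : Odd n := by
  by_contra hodd
  obtain ⟨m, rfl⟩ := Nat.not_odd_iff_even.mp hodd
  obtain ⟨k, rfl⟩ : ∃ k, m = k + 2 := ⟨m - 2, by omega⟩
  have hval (x : Fin (k + 2 + (k + 2))) (hx : x.val ≠ 0) :
      (-x).val = k + 2 + (k + 2) - x.val := by
    rw [Fin.val_neg, if_neg (fun h => hx (congrArg Fin.val h))]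
  let σ : cycleGraph (k + 2 + (k + 2)) ≃g cycleGraph (k + 2 + (k + 2)) :=
    ⟨Equiv.neg _, by
      intro a b
      change (cycleGraph (k + 2 + k + 2)).Adj (-a : Fin (k + 2 + k + 2)) (-b) ↔
        (cycleGraph (k + 2 + k + 2)).Adj a b
      rw [cycleGraph_adj, cycleGraph_adj, neg_sub_neg, neg_sub_neg, or_comm]⟩
  have hcon : (cycleGraph (k + 2 + (k + 2))).Connected :=
    cycleGraph_connected (n := k + 2 + (k + 1))
  let one : Fin (k + 2 + (k + 2)) := ⟨1, by omega⟩
  let mid : Fin (k + 2 + (k + 2)) := ⟨k + 2, by omega⟩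
  have hmid : -mid = mid := by
    ext; rw [hval _ (by simp [mid])]; simp [mid]
  obtain ⟨u, hu, hd⟩ := hres 0 mid (by simp [mid, Fin.ext_iff]) one (-one) (by
    rw [Ne, Fin.ext_iff, hval one one_ne_zero]; simp only [one]; omega)
  have hfix : -u = u := by
    rcases hu with rfl | rfl
    · simp
    · exact hmid
  have := hcon.dist_iso_apply σ u one
  change dist _ (-u) (-one) = _ at this
  rw [hfix] at this
  exact hd this.symm

/-- The longest path of a connected graph of maximum degree at most two is Hamiltonian. -/
lemma Connected.exists_equiv_adj_succ [Finite V] (hG : G.Connected)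
    (hdeg : ∀ v a b c, G.Adj v a → G.Adj v b → G.Adj v c → a = b ∨ a = c ∨ b = c) :
    ∃ n : ℕ, ∃ f : Fin n ≃ V, ∀ i j : Fin n, i.val + 1 = j.val → G.Adj (f i) (f j) := by
  have := hG.nonempty
  obtain ⟨u, v, p, hp, hmax⟩ := Walk.exists_isPath_forall_isPath_length_le_length G
  have hinj := hp.getVert_injOn
  have hclosed (i : ℕ) (hi : i ≤ p.length) (w : V) (hw : G.Adj (p.getVert i) w) :
      w ∈ p.support := by
    by_contra hws
    rcases Nat.eq_zero_or_pos i with rfl | hi0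
    · rw [Walk.getVert_zero] at hw
      have := hmax _ _ _ (hp.cons (h := hw.symm) hws)
      simp at this
    rcases hi.eq_or_lt with rfl | hlt
    · rw [Walk.getVert_length] at hw
      have := hmax _ _ _ (hp.concat hws hw)
      simp at this
    have h1 := p.adj_getVert_succ hlt
    have h2 := p.adj_getVert_succ (i := i - 1) (by omega)
    rw [Nat.sub_add_cancel hi0] at h2
    rcases hdeg _ _ _ _ h1 h2.symm hw with h | h | h
    · have := hinj (by simp; omega) (by simp; omega) h
      omega
    · exact hws (h ▸ p.getVert_mem_support _)
    · exact hws (h ▸ p.getVert_mem_support _)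
  have hall (w : V) : w ∈ p.support := by
    by_contra hw
    obtain ⟨q⟩ := hG.preconnected u w
    obtain ⟨d, -, hd1, hd2⟩ := q.exists_boundary_dart {x | x ∈ p.support} p.start_mem_support hw
    obtain ⟨i, hi, hil⟩ := Walk.mem_support_iff_exists_getVert.mp hd1
    exact hd2 (hclosed i hil _ (hi ▸ d.adj))
  refine ⟨p.length + 1, Equiv.ofBijective (fun i => p.getVert i) ⟨fun i j h => ?_, fun w => ?_⟩,
    fun i j h => ?_⟩
  · exact Fin.ext (hinj (by simp; omega) (by simp; omega) h)
  · obtain ⟨i, hi, hil⟩ := Walk.mem_support_iff_exists_getVert.mp (hall w)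
    exact ⟨⟨i, by omega⟩, hi⟩
  · have := p.adj_getVert_succ (i := i) (by omega)
    rw [h] at this
    exact this

/-- A finite connected graph of maximum degree at most two on at least three vertices is a path
or a cycle. -/
lemma Connected.exists_iso_pathGraph_or_cycleGraph [Fintype V] (hG : G.Connected)
    (hcard : 3 ≤ Fintype.card V)
    (hdeg : ∀ v a b c, G.Adj v a → G.Adj v b → G.Adj v c → a = b ∨ a = c ∨ b = c) :
    ∃ n, 3 ≤ n ∧ (Nonempty (G ≃g pathGraph n) ∨ Nonempty (G ≃g cycleGraph n)) := by
  obtain ⟨n, f, hf⟩ := hG.exists_equiv_adj_succ hdeg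
  have hn : 3 ≤ n := by simpa [← Fintype.card_congr f] using hcard
  have hlt (i j : Fin n) (hij : i < j) (h : G.Adj (f i) (f j)) :
      i.val + 1 = j.val ∨ (i.val = 0 ∧ j.val + 1 = n) := by
    rw [Fin.lt_def] at hij
    by_contra! hne
    rcases Nat.eq_zero_or_pos i.val with hi0 | hi0
    · have hj := hne.2 hi0
      have h1 := hf j ⟨j + 1, by omega⟩ rfl
      have h2 := hf ⟨j - 1, by omega⟩ j (by simp; omega)
      rcases hdeg _ _ _ _ h1 h2.symm h.symm with h | h | h <;>
        · have := congrArg Fin.val (f.injective h)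
          simp at this
          omega
    · have h1 := hf i ⟨i + 1, by omega⟩ rfl
      have h2 := hf ⟨i - 1, by omega⟩ i (by simp; omega)
      rcases hdeg _ _ _ _ h1 h2.symm h with h | h | h <;>
        · have := congrArg Fin.val (f.injective h)
          simp at this
          omega
  have hadj (i j : Fin n) (h : G.Adj (f i) (f j)) : i.val + 1 = j.val ∨ j.val + 1 = i.val ∨
      (i.val = 0 ∧ j.val + 1 = n) ∨ (j.val = 0 ∧ i.val + 1 = n) := by
    rcases lt_trichotomy i j with hij | rfl | hij
    · have := hlt i j hij h
      tauto
    · exact absurd h (G.irrefl)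
    · have := hlt j i hij h.symm
      tauto
  refine ⟨n, hn, ?_⟩
  by_cases hend : G.Adj (f ⟨0, by omega⟩) (f ⟨n - 1, by omega⟩)
  · refine Or.inr ⟨Iso.symm ⟨f, fun {i j} => ?_⟩⟩
    rw [cycleGraph_adj_iff_val (by omega)]
    refine ⟨hadj i j, ?_⟩
    rintro (h | h | ⟨h0, h⟩ | ⟨h0, h⟩)
    · exact hf i j h
    · exact (hf j i h).symm
    · convert hend using 3; omega
    · convert hend.symm using 3; omega
  · refine Or.inl ⟨Iso.symm ⟨f, fun {i j} => ?_⟩⟩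
    rw [pathGraph_adj]
    refine ⟨fun h => ?_, ?_⟩
    · rcases hadj i j h with h' | h' | ⟨h0, h'⟩ | ⟨h0, h'⟩
      · exact Or.inl h'
      · exact Or.inr h'
      · refine absurd ?_ hend
        convert h using 3 <;> omega
      · refine absurd ?_ hend
        convert h.symm using 3 <;> omega
    · rintro (h | h)
      · exact hf i j h
      · exact (hf j i h).symm

lemma CliqueFree.not_adj_of_adj_of_adj (h3 : G.CliqueFree 3) {v a b : V} (ha : G.Adj v a)
    (hb : G.Adj v b) : ¬G.Adj a b := by
  classical
  exact fun hab => h3 {v, a, b} (is3Clique_triple_iff.mpr ⟨ha, hb, hab⟩)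

lemma Connected.dist_eq_two (hG : G.Connected) {v a b : V} (hne : a ≠ b) (hab : ¬G.Adj a b)
    (ha : G.Adj v a) (hb : G.Adj v b) : G.dist a b = 2 := by
  have h1 := hG.one_lt_dist_of_ne_of_not_adj hne hab
  have h2 := hG.dist_triangle (u := a) (v := v) (w := b)
  rw [dist_eq_one_iff_adj.mpr ha.symm, dist_eq_one_iff_adj.mpr hb] at h2
  omega

lemma Connected.exists_iso_of_forall_isResolvingSet [Fintype V] (hG : G.Connected)
    (hcard : 3 ≤ Fintype.card V) (h3 : G.CliqueFree 3)
    (hres : ∀ u w : V, u ≠ w → IsResolvingSet G {u, w}) :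
    (∃ n : ℕ, 3 ≤ n ∧ Nonempty (G ≃g pathGraph n)) ∨
      (∃ n : ℕ, Odd n ∧ 5 ≤ n ∧ Nonempty (G ≃g cycleGraph n)) := by
  obtain ⟨n, hn, he | ⟨⟨e⟩⟩⟩ := hG.exists_iso_pathGraph_or_cycleGraph hcard (by
    intro v a b c ha hb hc
    by_contra! hne
    obtain ⟨u, hu, hd⟩ := hres v c hc.ne a b hne.1
    rcases hu with rfl | rfl
    · rw [dist_eq_one_iff_adj.mpr ha, dist_eq_one_iff_adj.mpr hb] at hd
      exact hd rfl
    · rw [hG.dist_eq_two hne.2.1.symm (h3.not_adj_of_adj_of_adj hc ha) hc ha,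
        hG.dist_eq_two hne.2.2.symm (h3.not_adj_of_adj_of_adj hc hb) hc hb] at hd
      exact hd rfl)
  · exact Or.inl ⟨n, hn, he⟩
  · have hodd : Odd n := by
      refine odd_of_forall_isResolvingSet_cycleGraph hn fun u w huw x y hxy => ?_
      obtain ⟨z, hz, hd⟩ := hres (e.symm u) (e.symm w) (e.symm.injective.ne huw)
        (e.symm x) (e.symm y) (e.symm.injective.ne hxy)
      refine ⟨e z, ?_, ?_⟩
      · rcases hz with rfl | rfl <;> simp
      · simpa [← hG.dist_iso_apply e] using hd
    refine Or.inr ⟨n, hodd, ?_, ⟨e⟩⟩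
    by_contra! hlt
    obtain rfl : n = 3 := by
      obtain ⟨k, rfl⟩ := hodd
      omega
    have hadj (i j : Fin 3) (h : i ≠ j) : G.Adj (e.symm i) (e.symm j) :=
      e.symm.map_adj_iff.mpr (by simpa [cycleGraph_three_eq_top] using h)
    exact h3.not_adj_of_adj_of_adj (hadj 0 1 (by simp)) (hadj 0 2 (by simp)) (hadj 1 2 (by simp))

lemma Connected.three_le_card_of_resolvingNumber_eq_two [Fintype V] (hG : G.Connected)
    (h : resolvingNumber G = 2) : 3 ≤ Fintype.card V := by
  classical
  have hnot : 1 ∉ {k | ∀ S : Finset V, S.card = k → IsResolvingSet G ↑S} :=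
    Nat.notMem_of_lt_sInf (by rw [← resolvingNumber, h]; norm_num)
  simp only [Set.mem_ofPred_eq, IsResolvingSet, not_forall] at hnot
  obtain ⟨S, hS, x, y, hxy, hu⟩ := hnot
  obtain ⟨u, rfl⟩ := Finset.card_eq_one.mp hS
  push Not at hu
  have hd := hu u (by simp)
  have hux : u ≠ x := by
    rintro rfl
    rw [dist_self] at hd
    exact hxy (hG.dist_eq_zero_iff.mp hd.symm)
  have huy : u ≠ y := by
    rintro rfl
    rw [dist_self] at hd
    exact hxy (hG.dist_eq_zero_iff.mp hd).symm
  rw [← Finset.card_eq_three.mpr ⟨u, x, y, hux, huy, hxy, rfl⟩]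
  exact Finset.card_le_univ _

lemma isResolvingSet_pair_of_resolvingNumber_eq_two [Fintype V] (h : resolvingNumber G = 2)
    {u w : V} (huw : u ≠ w) : IsResolvingSet G {u, w} := by
  classical
  have hmem := Nat.sInf_mem (Nat.nonempty_of_pos_sInf
    (s := {k | ∀ S : Finset V, S.card = k → IsResolvingSet G ↑S})
    (by rw [← resolvingNumber, h]; norm_num))
  rw [← resolvingNumber, h] at hmem
  simpa using hmem {u, w} (Finset.card_pair huw)

end SimpleGraph

theorem stmt9 {V : Type*} [Fintype V] (G : SimpleGraph V) (hG : G.Connected) :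
    (G.cliqueNum = 2 ∧ resolvingNumber G = 2) ↔
      (∃ n : ℕ, 3 ≤ n ∧ Nonempty (G ≃g pathGraph n)) ∨
      (∃ n : ℕ, Odd n ∧ 5 ≤ n ∧ Nonempty (G ≃g cycleGraph n)) := by
  constructor
  · rintro ⟨hω, hres⟩
    exact hG.exists_iso_of_forall_isResolvingSet
      (hG.three_le_card_of_resolvingNumber_eq_two hres)
      (cliqueFree_three_of_cliqueNum_eq_two hω)
      fun _ _ huw => isResolvingSet_pair_of_resolvingNumber_eq_two hres huw
  · rintro (⟨n, hn, ⟨e⟩⟩ | ⟨n, hodd, hn, ⟨e⟩⟩)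
    · exact hG.cliqueNum_and_resolvingNumber_of_iso_pathGraph hn e
    · exact hG.cliqueNum_and_resolvingNumber_of_iso_cycleGraph hodd hn e
end

section
/- Let G be a finite connected simple graph on n vertices that is not isomorphic to any path graph and not isomorphic to any cycle graph. If the girth of G equals 5, then n ≤ 5·res(G) − 5. -/
open SimpleGraph

lemma card_lt_resolvingNumber_s13 {V : Type*} [Fintype V] (G : SimpleGraph V) {x y : V}
    (hxy : x ≠ y) (E : Finset V) (hE : ∀ u ∈ E, G.dist u x = G.dist u y) :
    E.card < resolvingNumber G := by
  have hmem : resolvingNumber G ∈ {k | ∀ S : Finset V, S.card = k → IsResolvingSet G ↑S} :=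
    Nat.sInf_mem ⟨Fintype.card V + 1, fun S hS => by
      have := S.card_le_univ
      omega⟩
  by_contra! h
  obtain ⟨S, hSE, hS⟩ := Finset.exists_subset_card_eq h
  obtain ⟨u, hu, hne⟩ := hmem S hS x y hxy
  exact hne (hE u (hSE hu))

/-- Along a closed walk of length five, the distance from a fixed vertex is constant on
some edge, since five steps of size one cannot sum to zero. -/
lemma exists_dist_getVert_eq {V : Type*} {G : SimpleGraph V} (hG : G.Connected) {a : V}
    (w : G.Walk a a) (hw : w.length = 5) (u : V) :
    ∃ i ∈ Finset.range 5, G.dist u (w.getVert i) = G.dist u (w.getVert (i + 1)) := by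
  have hstep : ∀ i < 5, G.dist u (w.getVert i) ≤ G.dist u (w.getVert (i + 1)) + 1 ∧
      G.dist u (w.getVert (i + 1)) ≤ G.dist u (w.getVert i) + 1 := by
    intro i hi
    have hadj : G.Adj (w.getVert i) (w.getVert (i + 1)) := w.adj_getVert_succ (by omega)
    have h₁ : G.dist u _ ≤ _ := hG.dist_triangle (v := w.getVert i) (w := w.getVert (i + 1))
    have h₂ : G.dist u _ ≤ _ := hG.dist_triangle (v := w.getVert (i + 1)) (w := w.getVert i)
    rw [dist_eq_one_iff_adj.mpr hadj] at h₁
    rw [dist_eq_one_iff_adj.mpr hadj.symm] at h₂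
    exact ⟨h₂, h₁⟩
  by_contra! hne
  simp only [Finset.mem_range] at hne
  have hclosed : w.getVert 5 = w.getVert 0 := by
    rw [← hw, w.getVert_length, w.getVert_zero]
  have s₀ := hstep 0 (by omega)
  have s₁ := hstep 1 (by omega)
  have s₂ := hstep 2 (by omega)
  have s₃ := hstep 3 (by omega)
  have s₄ := hstep 4 (by omega)
  have n₀ := hne 0 (by omega)
  have n₁ := hne 1 (by omega)
  have n₂ := hne 2 (by omega)
  have n₃ := hne 3 (by omega)
  have n₄ := hne 4 (by omega)
  simp only [Nat.reduceAdd, zero_add, hclosed] at *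
  omega

theorem stmt13 {V : Type*} [Fintype V] (G : SimpleGraph V) (hG : G.Connected)
    (hpath : ¬ ∃ n : ℕ, Nonempty (G ≃g pathGraph n))
    (hcycle : ¬ ∃ n : ℕ, Nonempty (G ≃g cycleGraph n))
    (hgirth : G.egirth = 5) :
    Fintype.card V ≤ 5 * resolvingNumber G - 5 := by
  classical
  have hcyc : ¬ G.IsAcyclic := by
    rw [← egirth_eq_top, hgirth]
    decide
  obtain ⟨a, w, -, hlen⟩ := exists_egirth_eq_length.mpr hcyc
  have hw : w.length = 5 := by
    rw [hgirth] at hlen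
    exact_mod_cast hlen.symm
  let E : ℕ → Finset V := fun i =>
    Finset.univ.filter fun u => G.dist u (w.getVert i) = G.dist u (w.getVert (i + 1))
  have hE : ∀ i ∈ Finset.range 5, (E i).card ≤ resolvingNumber G - 1 := by
    intro i hi
    have hne : w.getVert i ≠ w.getVert (i + 1) :=
      (w.adj_getVert_succ (by simpa [hw] using hi)).ne
    have := card_lt_resolvingNumber_s13 G hne (E i) fun u hu => (Finset.mem_filter.mp hu).2
    omega
  have hcover : (Finset.univ : Finset V) ⊆ (Finset.range 5).biUnion E := by
    intro u _
    obtain ⟨i, hi, h⟩ := exists_dist_getVert_eq hG w hw u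
    exact Finset.mem_biUnion.mpr ⟨i, hi, by simpa [E] using h⟩
  have hcard := (Finset.card_le_card hcover).trans (Finset.card_biUnion_le_card_mul _ _ _ hE)
  rw [Finset.card_univ, Finset.card_range] at hcard
  omega
end

section
/- Let G be a finite connected simple graph on n vertices that is not isomorphic to any path graph and not isomorphic to any cycle graph. If the girth of G is strictly greater than 5 (possibly infinite) and the maximum degree Δ(G) is strictly greater than 3, then n ≤ 5·res(G) − 9. -/
open SimpleGraph

theorem four_le_card_offDiag_eq (g : Fin 5 → Fin 3) :
    4 ≤ (Finset.univ.offDiag.filter fun p : Fin 5 × Fin 5 => g p.1 = g p.2).card := by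
  revert g
  decide +kernel

theorem twelve_le_card_offDiag_eq (g : Fin 5 → Fin 3) (h : ∀ j, j ≠ 0 → g j = 2) :
    12 ≤ (Finset.univ.offDiag.filter fun p : Fin 5 × Fin 5 => g p.1 = g p.2).card := by
  revert g
  decide +kernel

theorem six_le_card_offDiag_eq (g : Fin 5 → Fin 3) (i : Fin 5)
    (h : ∀ j, j ≠ 0 → j ≠ i → g j = 2) :
    6 ≤ (Finset.univ.offDiag.filter fun p : Fin 5 × Fin 5 => g p.1 = g p.2).card := by
  revert g i
  decide +kernel

/-- Fewer than `resolvingNumber G` vertices are equidistant from two given vertices. -/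
theorem card_equidistant_lt_resolvingNumber {V : Type*} [Fintype V] (G : SimpleGraph V)
    {x y : V} (hxy : x ≠ y) :
    (Finset.univ.filter fun u => G.dist u x = G.dist u y).card < resolvingNumber G := by
  have hmem : resolvingNumber G ∈ {k | ∀ S : Finset V, S.card = k → IsResolvingSet G ↑S} :=
    Nat.sInf_mem ⟨Fintype.card V + 1, fun S hS => by
      have := S.card_le_univ
      omega⟩
  by_contra! hle
  obtain ⟨S, hS, hcard⟩ := Finset.exists_subset_card_eq hle
  obtain ⟨u, hu, hne⟩ := hmem S hcard x y hxy
  exact hne (Finset.mem_filter.1 (hS hu)).2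

theorem not_adj_of_common_neighbor_of_three_lt_egirth {V : Type*} {G : SimpleGraph V}
    (hg : 3 < G.egirth) {v a b : V} (ha : G.Adj v a) (hb : G.Adj v b) : ¬ G.Adj a b := by
  classical
  intro hab
  obtain ⟨u, w, hw, hl⟩ :=
    (is3Clique_iff_exists_cycle_length_three (G := G)).1
      ⟨{v, a, b}, is3Clique_triple_iff.2 ⟨ha, hb, hab⟩⟩
  have h := egirth_le_length hw
  rw [hl] at h
  exact absurd hg (not_lt.2 (by exact_mod_cast h))

/-- Counting, over all vertices, the pairs of vertices of a star that are equidistant from it. -/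
theorem card_le_of_star {V : Type*} [Fintype V] (G : SimpleGraph V)
    (hG : G.Connected) (hg : 3 < G.egirth) (x : Fin 5 → V) (hx : Function.Injective x)
    (hadj : ∀ i, i ≠ 0 → G.Adj (x 0) (x i)) :
    4 * Fintype.card V + 16 ≤ 20 * (resolvingNumber G - 1) := by
  classical
  have hrel (u : V) : ∃ g : Fin 5 → Fin 3,
      ∀ i, G.dist u (x i) + 1 = G.dist u (x 0) + (g i : ℕ) := by
    have hb (i : Fin 5) :
        G.dist u (x 0) ≤ G.dist u (x i) + 1 ∧ G.dist u (x i) + 1 < G.dist u (x 0) + 3 := by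
      by_cases hi : i = 0
      · subst hi
        omega
      · have h1 : G.dist (x 0) (x i) = 1 := dist_eq_one_iff_adj.2 (hadj i hi)
        have h2 := hG.dist_triangle (u := u) (v := x 0) (w := x i)
        have h3 := hG.dist_triangle (u := u) (v := x i) (w := x 0)
        rw [G.dist_comm (u := x i)] at h3
        omega
    refine ⟨fun i => ⟨G.dist u (x i) + 1 - G.dist u (x 0), ?_⟩, fun i => ?_⟩
    · have := hb i
      omega
    · exact (Nat.add_sub_cancel' (hb i).1).symm
  have hlow (u : V) : 4 + ∑ i, (if u = x i then (if i = 0 then 8 else 2) else 0) ≤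
      ((Finset.univ : Finset (Fin 5)).offDiag.filter
        fun p => G.dist u (x p.1) = G.dist u (x p.2)).card := by
    obtain ⟨g, hgu⟩ := hrel u
    have heq : (Finset.univ.offDiag.filter fun p : Fin 5 × Fin 5 =>
        G.dist u (x p.1) = G.dist u (x p.2)) =
        Finset.univ.offDiag.filter fun p : Fin 5 × Fin 5 => g p.1 = g p.2 := by
      refine Finset.filter_congr fun p _ => ?_
      have h1 := hgu p.1
      have h2 := hgu p.2
      rw [Fin.ext_iff]
      omega
    rw [heq]
    by_cases hu : ∃ i, u = x i
    · obtain ⟨i, rfl⟩ := hu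
      simp only [hx.eq_iff, Finset.sum_ite_eq, Finset.mem_univ, if_true]
      split_ifs with hi
      · subst hi
        refine twelve_le_card_offDiag_eq g fun j hj => ?_
        have h1 := hgu j
        rw [dist_eq_one_iff_adj.2 (hadj j hj), SimpleGraph.dist_self] at h1
        exact Fin.ext (by simpa using h1.symm)
      · refine six_le_card_offDiag_eq g i fun j hj hji => ?_
        have h1 := hgu j
        have hna := not_adj_of_common_neighbor_of_three_lt_egirth hg (hadj i hi) (hadj j hj)
        have h2 : G.dist (x i) (x j) ≠ 1 := fun h => hna (dist_eq_one_iff_adj.1 h)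
        have h3 : 0 < G.dist (x i) (x j) := hG.pos_dist_of_ne (hx.ne hji.symm)
        rw [dist_eq_one_iff_adj.2 (hadj i hi).symm] at h1
        have h4 := (g j).isLt
        apply Fin.ext
        change (g j : ℕ) = 2
        omega
    · push Not at hu
      simpa [hu] using four_le_card_offDiag_eq g
  have hup (p : Fin 5 × Fin 5) (hp : p ∈ (Finset.univ : Finset (Fin 5)).offDiag) :
      (Finset.univ.filter fun u => G.dist u (x p.1) = G.dist u (x p.2)).card ≤
        resolvingNumber G - 1 :=
    Nat.le_sub_one_of_lt
      (card_equidistant_lt_resolvingNumber G (hx.ne (Finset.mem_offDiag.1 hp).2.2))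
  calc 4 * Fintype.card V + 16
      = ∑ u : V, (4 + ∑ i, (if u = x i then (if i = 0 then 8 else 2) else 0)) := by
        rw [Finset.sum_add_distrib, Finset.sum_comm]
        simp [Fin.sum_univ_succ, mul_comm]
    _ ≤ ∑ u : V, ((Finset.univ : Finset (Fin 5)).offDiag.filter
        fun p => G.dist u (x p.1) = G.dist u (x p.2)).card := Finset.sum_le_sum fun u _ => hlow u
    _ = ∑ p ∈ (Finset.univ : Finset (Fin 5)).offDiag,
        (Finset.univ.filter fun u => G.dist u (x p.1) = G.dist u (x p.2)).card := by
        simp only [Finset.card_filter]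
        exact Finset.sum_comm
    _ ≤ ∑ p ∈ (Finset.univ : Finset (Fin 5)).offDiag, (resolvingNumber G - 1) :=
        Finset.sum_le_sum hup
    _ = 20 * (resolvingNumber G - 1) := by simp [Finset.offDiag_card]

theorem stmt14 {V : Type*} [Fintype V] (G : SimpleGraph V) [DecidableRel G.Adj]
    (hG : G.Connected)
    (hpath : ¬ ∃ n : ℕ, Nonempty (G ≃g pathGraph n))
    (hcycle : ¬ ∃ n : ℕ, Nonempty (G ≃g cycleGraph n))
    (hgirth : 5 < G.egirth) (hdeg : 3 < G.maxDegree) :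
    Fintype.card V ≤ 5 * resolvingNumber G - 9 := by
  have := hG.nonempty
  obtain ⟨v, hv⟩ := G.exists_maximal_degree_vertex
  rw [hv, ← card_neighborFinset_eq_degree] at hdeg
  obtain ⟨S, hS, hcard⟩ := Finset.exists_subset_card_eq (Nat.succ_le_of_lt hdeg)
  let e := (S.equivFinOfCardEq hcard).symm
  have hadj (i : Fin 4) : G.Adj v (e i) := (G.mem_neighborFinset v _).1 (hS (e i).2)
  have key := card_le_of_star G hG (lt_trans (by norm_num) hgirth)
    (Fin.cons v fun i => (e i : V))
    (Fin.cons_injective_iff.2 ⟨fun ⟨i, hi⟩ => (hadj i).ne hi.symm,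
      Subtype.val_injective.comp e.injective⟩)
    (fun i hi => by
      obtain ⟨j, rfl⟩ := Fin.exists_succ_eq.2 hi
      simpa using hadj j)
  omega
end
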